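/- Weakening of labeled concepts (w) is hp-admissible in S(O): if the sequent Γ ⊢ Δ has a proof of height h in S(O) and x is a label occurring in Γ ⊢ Δ, then for any RIQ concept C the sequent Γ ⊢ Δ, x : C has a proof of height at most h in S(O). -/

import Mathlib

set_option maxHeartbeats 1000000

namespace RIQ

/-- Roles: role names and inverse roles. -/
inductive Role : Type
  | name : ℕ → Role
  | inv  : ℕ → Role
deriving DecidableEq

/-- The inverse of a role. -/
def Role.invert : Role → Role
  | .name r => .inv r
  | .inv r  => .name r

/-- RIQ concepts in negation normal form. -/
inductive Concept : Type
  | atom : ℕ → Concept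
  | nneg : ℕ → Concept
  | inter : Concept → Concept → Concept
  | union : Concept → Concept → Concept
  | ex : Role → Concept → Concept
  | all : Role → Concept → Concept
  | atMost : ℕ → Role → Concept → Concept
  | atLeast : ℕ → Role → Concept → Concept
deriving DecidableEq

/-- ⊤ := A₀ ⊔ ¬A₀ for the fixed concept name A₀ = 0. -/
def topC : Concept := .union (.atom 0) (.nneg 0)

/-- ⊥ := A₀ ⊓ ¬A₀ for the fixed concept name A₀ = 0. -/
def botC : Concept := .inter (.atom 0) (.nneg 0)

/-- NNF-negation. -/
def nnfNeg : Concept → Concept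
  | .atom A => .nneg A
  | .nneg A => .atom A
  | .inter C D => .union (nnfNeg C) (nnfNeg D)
  | .union C D => .inter (nnfNeg C) (nnfNeg D)
  | .ex r C => .all r (nnfNeg C)
  | .all r C => .ex r (nnfNeg C)
  | .atMost n r C => .atLeast (n+1) r C
  | .atLeast 0 _ _ => botC
  | .atLeast (n+1) r C => .atMost n r C

/-- Literals: concept names and their negations. -/
def IsLiteral : Concept → Prop
  | .atom _ => True
  | .nneg _ => True
  | _ => False

/-- A complex role inclusion axiom r₁ ∘ ⋯ ∘ rₙ ⊑ s. -/
structure RIA where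
  lhs : List Role
  rhs : Role
deriving DecidableEq

/-- An ontology: a finite set of RIAs (RBox) together with a finite set of
GCIs (TBox), each GCI ⊤ ⊑ C being recorded by its right-hand concept C. -/
structure Ontology where
  rias : Finset RIA
  gcis : Finset Concept

/-- Union of two ontologies. -/
def Ontology.union (O₁ O₂ : Ontology) : Ontology := ⟨O₁.rias ∪ O₂.rias, O₁.gcis ∪ O₂.gcis⟩

/-- Concept names occurring in a concept. -/
def cnames : Concept → Finset ℕ
  | .atom A => {A}
  | .nneg A => {A}
  | .inter C D => cnames C ∪ cnames D
  | .union C D => cnames C ∪ cnames D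
  | .ex _ C => cnames C
  | .all _ C => cnames C
  | .atMost _ _ C => cnames C
  | .atLeast _ _ C => cnames C

/-- Concept names occurring in an ontology. -/
def Ontology.cnames (O : Ontology) : Finset ℕ := O.gcis.sup RIQ.cnames

/-- An interpretation over the domain δ. -/
structure Interp (δ : Type) where
  cI : ℕ → Set δ
  rI : ℕ → Set (δ × δ)

/-- Interpretation of roles. -/
def Interp.roleI {δ : Type} (I : Interp δ) : Role → Set (δ × δ)
  | .name r => I.rI r
  | .inv r  => {p | (p.2, p.1) ∈ I.rI r}

/-- Relational composition of a list of roles (empty composition is the identity). -/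
def Interp.listComp {δ : Type} (I : Interp δ) : List Role → Set (δ × δ)
  | [] => {p | p.1 = p.2}
  | r :: rs => {p | ∃ b, (p.1, b) ∈ I.roleI r ∧ (b, p.2) ∈ I.listComp rs}

/-- Interpretation of concepts. -/
def Interp.cInterp {δ : Type} (I : Interp δ) : Concept → Set δ
  | .atom A => I.cI A
  | .nneg A => (I.cI A)ᶜ
  | .inter C D => I.cInterp C ∩ I.cInterp D
  | .union C D => I.cInterp C ∪ I.cInterp D
  | .ex r C => {a | ∃ b, (a, b) ∈ I.roleI r ∧ b ∈ I.cInterp C}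
  | .all r C => {a | ∀ b, (a, b) ∈ I.roleI r → b ∈ I.cInterp C}
  | .atMost n r C => {a | {b | (a, b) ∈ I.roleI r ∧ b ∈ I.cInterp C}.encard ≤ (n : ℕ∞)}
  | .atLeast n r C => {a | (n : ℕ∞) ≤ {b | (a, b) ∈ I.roleI r ∧ b ∈ I.cInterp C}.encard}

/-- I ⊨ O. -/
def Interp.models {δ : Type} (I : Interp δ) (O : Ontology) : Prop :=
  (∀ C ∈ O.gcis, I.cInterp topC ⊆ I.cInterp C) ∧
  (∀ ria ∈ O.rias, I.listComp ria.lhs ⊆ I.roleI ria.rhs)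

/-- O ⊨ C ⊑ D. -/
def entails (O : Ontology) (C D : Concept) : Prop :=
  ∀ (δ : Type) [Nonempty δ] (I : Interp δ), I.models O → I.cInterp C ⊆ I.cInterp D

/-- Production rules of the R-system G(O). -/
def ProdRule (O : Ontology) (s : Role) (T : List Role) : Prop :=
  ∃ ria ∈ O.rias, (s = ria.rhs ∧ T = ria.lhs) ∨
    (s = ria.rhs.invert ∧ T = (ria.lhs.map Role.invert).reverse)

/-- One-step derivation in the R-system G(O). -/
def OneStep (O : Ontology) (S R : List Role) : Prop :=
  ∃ S' s T R', ProdRule O s T ∧ S = S' ++ s :: R' ∧ R = S' ++ T ++ R'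

/-- The language L_{G(O)}(r). -/
def lang (O : Ontology) (r : Role) : Set (List Role) :=
  {S | Relation.ReflTransGen (OneStep O) [r] S}

/-- Structural atoms: role atoms, equality atoms and inequality atoms
(labels are natural numbers). -/
inductive SAtom : Type
  | rel : Role → ℕ → ℕ → SAtom
  | eq : ℕ → ℕ → SAtom
  | neq : ℕ → ℕ → SAtom
deriving DecidableEq

/-- Labels occurring in a structural atom. -/
def SAtom.labels : SAtom → Finset ℕ
  | .rel _ x y => {x, y}
  | .eq x y => {x, y}
  | .neq x y => {x, y}

/-- Labeled concepts. -/
abbrev LC := ℕ × Concept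

/-- Labels occurring in a finite set of structural atoms. -/
def labSetF (Γ : Finset SAtom) : Finset ℕ := Γ.biUnion SAtom.labels

/-- Labels occurring in a multiset of labeled concepts. -/
def Δlabels (Δ : Multiset LC) : Finset ℕ := (Δ.map Prod.fst).toFinset

/-- One step of the equality chain x ≈ y (an equality atom in either orientation). -/
def eqStep (Γ : Set SAtom) (x y : ℕ) : Prop := SAtom.eq x y ∈ Γ ∨ SAtom.eq y x ∈ Γ

/-- x ∼_Γ y : x and y are linked by a finite chain of equality atoms of Γ. -/
def eqRel (Γ : Set SAtom) : ℕ → ℕ → Prop := Relation.ReflTransGen (eqStep Γ)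

/-- Edge of the propagation graph PG(Γ) between the classes of x and y, labeled r. -/
def pgEdge (Γ : Set SAtom) (x : ℕ) (r : Role) (y : ℕ) : Prop :=
  (∃ z w, eqRel Γ x z ∧ eqRel Γ y w ∧ SAtom.rel r z w ∈ Γ) ∨
  (∃ z w, eqRel Γ y z ∧ eqRel Γ x w ∧ SAtom.rel r.invert z w ∈ Γ)

/-- Propagation paths: PG(Γ) ⊨ [x]_Γ ⟶^S [y]_Γ for a string S of roles. -/
def pgPath (Γ : Set SAtom) : List Role → ℕ → ℕ → Prop
  | [], x, y => eqRel Γ x y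
  | r :: S, x, y => ∃ z, pgEdge Γ x r z ∧ pgPath Γ S z y

/-- PG(Γ) ⊨ [x]_Γ ⟶^L [y]_Γ with L = L_{G(O)}(r). -/
def pgLang (Γ : Set SAtom) (O : Ontology) (r : Role) (x y : ℕ) : Prop :=
  ∃ S ∈ lang O r, pgPath Γ S x y

/-- The edge relation of the directed graph determined by the role atoms of Γ. -/
def edgeRel (Γ : Set SAtom) (x y : ℕ) : Prop := ∃ r, SAtom.rel r x y ∈ Γ

/-- Γ forms a (directed) tree. -/
def FormsTree (Γ : Finset SAtom) : Prop :=
  Γ = ∅ ∨ ∃ root ∈ labSetF Γ,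
    (∀ x ∈ labSetF Γ, Relation.ReflTransGen (edgeRel ↑Γ) root x) ∧
    (∀ y, ¬ edgeRel ↑Γ y root) ∧
    (∀ x y y', edgeRel ↑Γ y x → edgeRel ↑Γ y' x → y = y')

/-- Γ ⊢ Δ is a sequent. -/
def IsSequent (Γ : Finset SAtom) (Δ : Multiset LC) : Prop :=
  FormsTree Γ ∧
  (Γ ≠ ∅ → ∀ p ∈ Δ, p.1 ∈ labSetF Γ) ∧
  (Γ = ∅ → ∃ x, Δlabels Δ = {x})

/-- y : O̅, the multiset of labeled concepts y : ¬̇C for the GCIs ⊤ ⊑ C of O. -/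
def obar (O : Ontology) (y : ℕ) : Multiset LC := O.gcis.val.map (fun C => (y, nnfNeg C))

/-- x : O̅ for every label x in a given finite set of labels. -/
def obarFor (O : Ontology) (ls : Finset ℕ) : Multiset LC := ls.val.bind (obar O)

/-- y is fresh, i.e. does not occur in the sequent Γ ⊢ Δ. -/
def FreshLabel (y : ℕ) (Γ : Finset SAtom) (Δ : Multiset LC) : Prop :=
  y ∉ labSetF Γ ∧ ∀ p ∈ Δ, p.1 ≠ y

/-- The set {yᵢ ≠̇ yⱼ | i < j}. -/
def neqSet {n : ℕ} (ys : Fin n → ℕ) : Finset SAtom :=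
  ((Finset.univ : Finset (Fin n × Fin n)).filter (fun p => p.1 < p.2)).image
    (fun p => SAtom.neq (ys p.1) (ys p.2))

/-- The set {r(x, yᵢ) | i}. -/
def relSet {n : ℕ} (r : Role) (x : ℕ) (ys : Fin n → ℕ) : Finset SAtom :=
  (Finset.univ : Finset (Fin n)).image (fun i => SAtom.rel r x (ys i))

/-- The multiset y₀ : ¬̇C, y₀ : O̅, …, yₙ : ¬̇C, yₙ : O̅. -/
def leΔ (O : Ontology) (C : Concept) {n : ℕ} (ys : Fin n → ℕ) : Multiset LC :=
  ∑ i : Fin n, ((ys i, nnfNeg C) ::ₘ obar O (ys i))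

/-- The sequent calculus S(O): `Deriv O Γ Δ n` states that the sequent Γ ⊢ Δ has
a proof in S(O) of height at most n. -/
inductive Deriv (O : Ontology) : Finset SAtom → Multiset LC → ℕ → Prop
  | id (Γ : Finset SAtom) (Δ : Multiset LC) (x A : ℕ) (n : ℕ) :
      Deriv O Γ ((x, Concept.atom A) ::ₘ (x, Concept.nneg A) ::ₘ Δ) n
  | idEq (Γ : Finset SAtom) (Δ : Multiset LC) (x y : ℕ) (n : ℕ)
      (hmem : SAtom.neq x y ∈ Γ) (h : eqRel ↑Γ x y) :
      Deriv O Γ Δ n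
  | subst (Γ : Finset SAtom) (Δ : Multiset LC) (x y : ℕ) (L : Concept) (n : ℕ)
      (hL : IsLiteral L) (h : eqRel ↑Γ x y)
      (p : Deriv O Γ ((x, L) ::ₘ (y, L) ::ₘ Δ) n) :
      Deriv O Γ ((x, L) ::ₘ Δ) (n + 1)
  | orR (Γ : Finset SAtom) (Δ : Multiset LC) (x : ℕ) (C D : Concept) (n : ℕ)
      (p : Deriv O Γ ((x, C) ::ₘ (x, D) ::ₘ Δ) n) :
      Deriv O Γ ((x, Concept.union C D) ::ₘ Δ) (n + 1)
  | andR (Γ : Finset SAtom) (Δ : Multiset LC) (x : ℕ) (C D : Concept) (n : ℕ)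
      (p : Deriv O Γ ((x, C) ::ₘ Δ) n) (q : Deriv O Γ ((x, D) ::ₘ Δ) n) :
      Deriv O Γ ((x, Concept.inter C D) ::ₘ Δ) (n + 1)
  | exR (Γ : Finset SAtom) (Δ : Multiset LC) (x y : ℕ) (r : Role) (C : Concept) (n : ℕ)
      (h : pgLang ↑Γ O r x y)
      (p : Deriv O Γ ((x, Concept.ex r C) ::ₘ (y, C) ::ₘ Δ) n) :
      Deriv O Γ ((x, Concept.ex r C) ::ₘ Δ) (n + 1)
  | allR (Γ : Finset SAtom) (Δ : Multiset LC) (x y : ℕ) (r : Role) (C : Concept) (n : ℕ)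
      (hy : FreshLabel y Γ ((x, Concept.all r C) ::ₘ Δ))
      (p : Deriv O (insert (SAtom.rel r x y) Γ) ((y, C) ::ₘ (obar O y + Δ)) n) :
      Deriv O Γ ((x, Concept.all r C) ::ₘ Δ) (n + 1)
  | leR (Γ : Finset SAtom) (Δ : Multiset LC) (x : ℕ) (r : Role) (C : Concept)
      (k : ℕ) (n : ℕ) (ys : Fin (k + 1) → ℕ)
      (hinj : Function.Injective ys)
      (hfresh : ∀ i, FreshLabel (ys i) Γ ((x, Concept.atMost k r C) ::ₘ Δ))
      (p : Deriv O (Γ ∪ neqSet ys ∪ relSet r x ys) (leΔ O C ys + Δ) n) :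
      Deriv O Γ ((x, Concept.atMost k r C) ::ₘ Δ) (n + 1)
  | geR (Γ : Finset SAtom) (Δ : Multiset LC) (x : ℕ) (r : Role) (C : Concept)
      (k : ℕ) (n : ℕ) (ys : Fin k → ℕ)
      (hpath : ∀ i, pgLang ↑Γ O r x (ys i))
      (p : ∀ i, Deriv O Γ ((ys i, C) ::ₘ (x, Concept.atLeast k r C) ::ₘ Δ) n)
      (q : ∀ i j : Fin k, i < j →
        Deriv O (insert (SAtom.eq (ys i) (ys j)) Γ) ((x, Concept.atLeast k r C) ::ₘ Δ) n) :
      Deriv O Γ ((x, Concept.atLeast k r C) ::ₘ Δ) (n + 1)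

/-- S(O) ⊩ Γ ⊢ Δ. -/
def SProvable (O : Ontology) (Γ : Finset SAtom) (Δ : Multiset LC) : Prop := ∃ n, Deriv O Γ Δ n

/-- Satisfaction of a structural atom under a label assignment. -/
def satAtom {δ : Type} (I : Interp δ) (lam : ℕ → δ) : SAtom → Prop
  | .rel r x y => (lam x, lam y) ∈ I.roleI r
  | .eq x y => lam x = lam y
  | .neq x y => lam x ≠ lam y

/-- I, λ ⊨^∀ Γ. -/
def satAll {δ : Type} (I : Interp δ) (lam : ℕ → δ) (Γ : Set SAtom) : Prop :=
  ∀ a ∈ Γ, satAtom I lam a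

/-- I, λ ⊨^∃ Δ. -/
def satEx {δ : Type} (I : Interp δ) (lam : ℕ → δ) (Δ : Multiset LC) : Prop :=
  ∃ p ∈ Δ, lam p.1 ∈ I.cInterp p.2

/-- ⊨_O Γ ⊢ Δ : validity of a sequent relative to O. -/
def ValidSeq (O : Ontology) (Γ : Finset SAtom) (Δ : Multiset LC) : Prop :=
  ∀ (δ : Type) [Nonempty δ] (I : Interp δ) (lam : ℕ → δ),
    I.models O → satAll I lam ↑Γ → satEx I lam Δ

/-- Label substitution (x/y) on labels: replace y by x. -/
def substLab (x y z : ℕ) : ℕ := if z = y then x else z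

/-- Label substitution (x/y) on structural atoms. -/
def SAtom.substL (x y : ℕ) : SAtom → SAtom
  | .rel r a b => .rel r (substLab x y a) (substLab x y b)
  | .eq a b => .eq (substLab x y a) (substLab x y b)
  | .neq a b => .neq (substLab x y a) (substLab x y b)

/-- Label substitution (x/y) on the antecedent. -/
def substΓ (x y : ℕ) (Γ : Finset SAtom) : Finset SAtom := Γ.image (SAtom.substL x y)

/-- Label substitution (x/y) on the consequent. -/
def substΔ (x y : ℕ) (Δ : Multiset LC) : Multiset LC := Δ.map (fun p => (substLab x y p.1, p.2))

/-- Exactly one of three propositions holds. -/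
def XOr3 (a b c : Prop) : Prop := (a ∧ ¬b ∧ ¬c) ∨ (¬a ∧ b ∧ ¬c) ∨ (¬a ∧ ¬b ∧ c)

/-- A member Γᵢ ⊢ Δᵢ of an interpolant. -/
abbrev ISeq := (Finset SAtom) × (Finset LC)

/-- 𝒢 is an interpolant: every member's antecedent consists of equality and
inequality atoms between distinct labels. -/
def IsInterpolant (G : Finset ISeq) : Prop :=
  ∀ p ∈ G, ∀ a ∈ p.1, ∃ x y : ℕ, x ≠ y ∧ (a = SAtom.eq x y ∨ a = SAtom.neq x y)

/-- The orthogonality condition between a member p of 𝒢 and a candidate q. -/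
def orthCond (p q : ISeq) : Prop :=
  XOr3 (∃ x y, SAtom.eq x y ∈ q.1 ∧ SAtom.neq x y ∈ p.1)
       (∃ x y, SAtom.neq x y ∈ q.1 ∧ SAtom.eq x y ∈ p.1)
       (∃ x C, (x, nnfNeg C) ∈ q.2 ∧ (x, C) ∈ p.2)

/-- The orthogonal 𝒢^⊥. -/
def OrthP (G : Set ISeq) : Set ISeq := {q | ∀ p ∈ G, orthCond p q}

/-- Labels occurring in a member of an interpolant. -/
def iseqLabels (p : ISeq) : Finset ℕ := labSetF p.1 ∪ p.2.image Prod.fst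

/-- Concept names occurring in a multiset of labeled concepts. -/
def ΔcnamesS (Δ : Multiset LC) : Set ℕ := {A | ∃ p ∈ Δ, A ∈ cnames p.2}

/-- Disjunction of a list of concepts. -/
def bigUnionL : List Concept → Concept
  | [] => botC
  | [C] => C
  | C :: D :: L => .union C (bigUnionL (D :: L))

/-- Conjunction of a list of concepts. -/
def bigInterL : List Concept → Concept
  | [] => topC
  | [C] => C
  | C :: D :: L => .inter C (bigInterL (D :: L))

/-- ⊓⊔𝒢 : the conjunction of the disjunctions of the members of 𝒢. -/
def interUnion (G : List (List Concept)) : Concept := bigInterL (G.map bigUnionL)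

/-- The interpolant {(⊢ x : C_{i,1}, …, x : C_{i,k_i}) | 1 ≤ i ≤ n}, as a set of ISeqs. -/
def simpleG (x : ℕ) (G : List (List Concept)) : Set ISeq :=
  {p | ∃ S ∈ G, p = (∅, (S.map (fun C => (x, C))).toFinset)}

/-- Renaming of concept names in a concept. -/
def renameC (ρ : ℕ → ℕ) : Concept → Concept
  | .atom A => .atom (ρ A)
  | .nneg A => .nneg (ρ A)
  | .inter C D => .inter (renameC ρ C) (renameC ρ D)
  | .union C D => .union (renameC ρ C) (renameC ρ D)
  | .ex r C => .ex r (renameC ρ C)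
  | .all r C => .all r (renameC ρ C)
  | .atMost n r C => .atMost n r (renameC ρ C)
  | .atLeast n r C => .atLeast n r (renameC ρ C)

/-- Renaming of concept names in an ontology. -/
def renameO (ρ : ℕ → ℕ) (O : Ontology) : Ontology := ⟨O.rias, O.gcis.image (renameC ρ)⟩

/-- C is implicitly concept-definable from Θ under O. -/
def ImplicitlyDefinable (C : Concept) (O : Ontology) (Θ : Finset ℕ) : Prop :=
  ∀ (δ : Type) [Nonempty δ] (I J : Interp δ), I.models O → J.models O →
    (∀ r, I.rI r = J.rI r) → (∀ A ∈ Θ, I.cI A = J.cI A) →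
    I.cInterp C = J.cInterp C

/-- C is explicitly concept-definable from Θ under O. -/
def ExplicitlyDefinable (C : Concept) (O : Ontology) (Θ : Finset ℕ) : Prop :=
  ∃ D : Concept, cnames D ⊆ Θ ∧ entails O C D ∧ entails O D C

/-- RIQ has the concept interpolation property. -/
def ConceptInterpolationProperty : Prop :=
  ∀ (O₁ O₂ : Ontology) (C D : Concept), entails (O₁.union O₂) C D →
    ∃ I : Concept, cnames I ⊆ (cnames C ∪ O₁.cnames) ∩ (cnames D ∪ O₂.cnames) ∧
      entails (O₁.union O₂) C I ∧ entails (O₁.union O₂) I D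

/-- RIQ has the concept-based Beth definability property. -/
def CBP : Prop :=
  ∀ (C : Concept) (O : Ontology) (Θ : Finset ℕ), Θ ⊆ cnames C ∪ O.cnames →
    ImplicitlyDefinable C O Θ → ExplicitlyDefinable C O Θ

/-- Renaming of the labels of a structural atom along an arbitrary map. -/
def SAtom.rename (σ : ℕ → ℕ) : SAtom → SAtom
  | .rel r x y => .rel r (σ x) (σ y)
  | .eq x y => .eq (σ x) (σ y)
  | .neq x y => .neq (σ x) (σ y)

theorem SAtom.rename_id (a : SAtom) : a.rename id = a := by
  cases a <;> rfl

theorem SAtom.rename_congr {σ τ : ℕ → ℕ} {a : SAtom} (h : ∀ z ∈ a.labels, σ z = τ z) :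
    a.rename σ = a.rename τ := by
  cases a <;> simp_all [SAtom.labels, SAtom.rename]

theorem image_rename_congr {σ τ : ℕ → ℕ} {Γ : Finset SAtom}
    (h : ∀ z ∈ labSetF Γ, σ z = τ z) :
    Γ.image (SAtom.rename σ) = Γ.image (SAtom.rename τ) :=
  Finset.image_congr fun a ha =>
    SAtom.rename_congr fun z hz => h z (Finset.mem_biUnion.2 ⟨a, ha, hz⟩)

theorem map_rename_congr {σ τ : ℕ → ℕ} {Δ : Multiset LC} (h : ∀ p ∈ Δ, σ p.1 = τ p.1) :
    Δ.map (Prod.map σ id) = Δ.map (Prod.map τ id) :=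
  Multiset.map_congr rfl fun p hp => Prod.ext (h p hp) rfl

theorem mem_image_rename {σ : ℕ → ℕ} {Γ : Finset SAtom} {a : SAtom} (h : a ∈ Γ) :
    a.rename σ ∈ Γ.image (SAtom.rename σ) :=
  Finset.mem_image_of_mem _ h

theorem eqRel.rename {σ : ℕ → ℕ} {Γ : Finset SAtom} {x y : ℕ} (h : eqRel ↑Γ x y) :
    eqRel ↑(Γ.image (SAtom.rename σ)) (σ x) (σ y) :=
  Relation.ReflTransGen.lift (r := eqStep ↑Γ) σ
    (fun _ _ hab => hab.imp (fun h => mem_image_rename h) (fun h => mem_image_rename h)) _ _ h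

theorem pgEdge.rename {σ : ℕ → ℕ} {Γ : Finset SAtom} {x y : ℕ} {r : Role}
    (h : pgEdge ↑Γ x r y) :
    pgEdge ↑(Γ.image (SAtom.rename σ)) (σ x) r (σ y) := by
  rcases h with ⟨z, w, hz, hw, h⟩ | ⟨z, w, hz, hw, h⟩
  · exact Or.inl ⟨σ z, σ w, hz.rename, hw.rename, mem_image_rename h⟩
  · exact Or.inr ⟨σ z, σ w, hz.rename, hw.rename, mem_image_rename h⟩

theorem pgPath.rename {σ : ℕ → ℕ} {Γ : Finset SAtom} {S : List Role} {x y : ℕ}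
    (h : pgPath ↑Γ S x y) :
    pgPath ↑(Γ.image (SAtom.rename σ)) S (σ x) (σ y) := by
  induction S generalizing x with
  | nil => exact eqRel.rename h
  | cons r S ih =>
    obtain ⟨z, hz, h⟩ := h
    exact ⟨σ z, hz.rename, ih h⟩

theorem pgLang.rename {σ : ℕ → ℕ} {Γ : Finset SAtom} {O : Ontology} {r : Role} {x y : ℕ}
    (h : pgLang ↑Γ O r x y) :
    pgLang ↑(Γ.image (SAtom.rename σ)) O r (σ x) (σ y) := by
  obtain ⟨S, hS, h⟩ := h
  exact ⟨S, hS, h.rename⟩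

theorem obar_rename (O : Ontology) (σ : ℕ → ℕ) (y : ℕ) :
    (obar O y).map (Prod.map σ id) = obar O (σ y) := by
  simp [obar]

theorem leΔ_rename (O : Ontology) (C : Concept) (σ : ℕ → ℕ) {n : ℕ} (ys : Fin n → ℕ) :
    (leΔ O C ys).map (Prod.map σ id) = leΔ O C (σ ∘ ys) := by
  simp only [leΔ, ← Multiset.coe_mapAddMonoidHom, map_sum]
  simp [obar_rename]

theorem neqSet_rename (σ : ℕ → ℕ) {n : ℕ} (ys : Fin n → ℕ) :
    (neqSet ys).image (SAtom.rename σ) = neqSet (σ ∘ ys) := by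
  simp [neqSet, Finset.image_image, Function.comp_def, SAtom.rename]

theorem relSet_rename (σ : ℕ → ℕ) (r : Role) (x : ℕ) {n : ℕ} (ys : Fin n → ℕ) :
    (relSet r x ys).image (SAtom.rename σ) = relSet r (σ x) (σ ∘ ys) := by
  simp [relSet, Finset.image_image, Function.comp_def, SAtom.rename]

/-- Infinitely many labels are fresh for a given sequent. -/
theorem exists_forall_le_freshLabel (Γ : Finset SAtom) (Δ : Multiset LC) :
    ∃ N, ∀ y, N ≤ y → FreshLabel y Γ Δ := by
  obtain ⟨N, hN⟩ := (labSetF Γ ∪ Δlabels Δ).bddAbove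
  refine ⟨N + 1, fun y hy => ⟨fun h => ?_, fun p hp h => ?_⟩⟩
  · have := hN (Finset.mem_coe.2 (Finset.mem_union_left _ h))
    omega
  · have hmem : p.1 ∈ Δlabels Δ := Multiset.mem_toFinset.2 (Multiset.mem_map_of_mem _ hp)
    have := hN (Finset.mem_coe.2 (Finset.mem_union_right _ hmem))
    omega

/-- Renaming of labels along an arbitrary map, combined with weakening by an arbitrary multiset
of labeled concepts, is height-preserving admissible. -/
theorem Deriv.rename_add {O : Ontology} {Γ : Finset SAtom} {Δ : Multiset LC} {n : ℕ}
    (hd : Deriv O Γ Δ n) (σ : ℕ → ℕ) (W : Multiset LC) :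
    Deriv O (Γ.image (SAtom.rename σ)) (Δ.map (Prod.map σ _root_.id) + W) n := by
  induction hd generalizing σ with
  | id Γ Δ x A n =>
    simp only [Multiset.map_cons, Multiset.cons_add]
    exact .id _ _ _ _ _
  | idEq Γ Δ x y n hmem h => exact .idEq _ _ (σ x) (σ y) _ (mem_image_rename hmem) h.rename
  | subst Γ Δ x y L n hL h _ ih =>
    have ih := ih σ
    simp only [Multiset.map_cons, Multiset.cons_add] at ih ⊢
    exact .subst _ _ _ _ _ _ hL h.rename ih
  | orR Γ Δ x C D n _ ih =>
    have ih := ih σ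
    simp only [Multiset.map_cons, Multiset.cons_add] at ih ⊢
    exact .orR _ _ _ _ _ _ ih
  | andR Γ Δ x C D n _ _ ihC ihD =>
    have ihC := ihC σ
    have ihD := ihD σ
    simp only [Multiset.map_cons, Multiset.cons_add] at ihC ihD ⊢
    exact .andR _ _ _ _ _ _ ihC ihD
  | exR Γ Δ x y r C n h _ ih =>
    have ih := ih σ
    simp only [Multiset.map_cons, Multiset.cons_add] at ih ⊢
    exact .exR _ _ _ _ _ _ _ h.rename ih
  | allR Γ Δ x y r C n hy _ ih =>
    obtain ⟨N, hN⟩ := exists_forall_le_freshLabel (Γ.image (SAtom.rename σ))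
      (((x, Concept.all r C) ::ₘ Δ).map (Prod.map σ _root_.id) + W)
    have hfresh := hN N le_rfl
    have hx : x ≠ y := hy.2 _ (Multiset.mem_cons_self _ _)
    have hΓ := image_rename_congr (σ := Function.update σ y N) (τ := σ) (Γ := Γ)
      fun z hz => Function.update_of_ne (ne_of_mem_of_not_mem hz hy.1) _ _
    have hΔ := map_rename_congr (σ := Function.update σ y N) (τ := σ) (Δ := Δ)
      fun p hp => Function.update_of_ne (hy.2 p (Multiset.mem_cons_of_mem hp)) _ _
    have ih := ih (Function.update σ y N)
    simp only [Finset.image_insert, Multiset.map_cons, Multiset.map_add, obar_rename, hΓ, hΔ,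
      SAtom.rename, Prod.map_apply, Function.update_self, Function.update_of_ne hx,
      Multiset.cons_add, add_assoc] at ih hfresh ⊢
    exact .allR _ _ _ N _ _ _ hfresh ih
  | leR Γ Δ x r C k n ys hinj hy _ ih =>
    obtain ⟨N, hN⟩ := exists_forall_le_freshLabel (Γ.image (SAtom.rename σ))
      (((x, Concept.atMost k r C) ::ₘ Δ).map (Prod.map σ _root_.id) + W)
    let zs : Fin (k + 1) → ℕ := fun i => N + i
    have hzs : Function.Injective zs := fun i j h => Fin.ext (Nat.add_left_cancel h)
    have hfresh : ∀ i, FreshLabel (zs i) _ _ := fun i => hN _ (Nat.le_add_right _ _)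
    have hσ : ∀ z, (∀ i, ys i ≠ z) → Function.extend ys zs σ z = σ z := fun z hz =>
      Function.extend_apply' _ _ _ fun ⟨i, hi⟩ => hz i hi
    have hx := hσ x fun i h => (hy i).2 _ (Multiset.mem_cons_self _ _) h.symm
    have hΓ := image_rename_congr (σ := Function.extend ys zs σ) (τ := σ) (Γ := Γ)
      fun z hz => hσ z fun i h => (hy i).1 (h ▸ hz)
    have hΔ := map_rename_congr (σ := Function.extend ys zs σ) (τ := σ) (Δ := Δ)
      fun p hp => hσ p.1 fun i h => (hy i).2 p (Multiset.mem_cons_of_mem hp) h.symm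
    have ih := ih (Function.extend ys zs σ)
    simp only [Finset.image_union, Multiset.map_add, neqSet_rename, relSet_rename, leΔ_rename,
      Function.extend_comp hinj, hx, hΓ, hΔ, add_assoc] at ih
    simp only [Multiset.map_cons, Multiset.cons_add] at hfresh ⊢
    exact .leR _ _ _ _ _ _ _ zs hzs hfresh ih
  | geR Γ Δ x r C k n ys hpath _ _ ihp ihq =>
    have ihp := fun i => ihp i σ
    have ihq := fun i j hij => ihq i j hij σ
    simp only [Multiset.map_cons, Multiset.cons_add, Finset.image_insert] at ihp ihq ⊢
    exact .geR _ _ _ _ _ _ _ (σ ∘ ys) (fun i => (hpath i).rename) ihp ihq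

/-- Weakening of labeled concepts (w) is hp-admissible in S(O). -/
theorem weakening_hp_admissible (O : Ontology) (Γ : Finset SAtom) (Δ : Multiset LC)
    (x : ℕ) (C : Concept) (h : ℕ)
    (hx : x ∈ labSetF Γ ∪ Δlabels Δ)
    (hd : Deriv O Γ Δ h) :
    Deriv O Γ ((x, C) ::ₘ Δ) h := by
  have hd' := hd.rename_add id {(x, C)}
  have hΓ : Γ.image (SAtom.rename id) = Γ := by
    simp [funext SAtom.rename_id]
  rwa [hΓ, Prod.map_id, Multiset.map_id, add_comm, Multiset.singleton_add] at hd'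

end RIQ
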